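/- For every positive integer n, ζ({3,1}^n) = 2·π^(4n) / (4n+2)!. -/

import Mathlib

/-- The multiple zeta value `ζ(s₁,…,s_d) = ∑_{k₁ > k₂ > ⋯ > k_d ≥ 1} 1/(k₁^{s₁} ⋯ k_d^{s_d})`. -/
noncomputable def mzv (s : List ℕ) : ℝ :=
  ∑' k : {k : Fin s.length → ℕ // StrictAnti k ∧ ∀ i, 0 < k i},
    ∏ i, 1 / ((k.1 i : ℝ) ^ s.get i)

open PowerSeries in
theorem alg_core (F G E : ℂ⟦X⟧) (t : ℂ)
    (hF : derivative ℂ (X * derivative ℂ F) = - C t * F * E)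
    (hG : derivative ℂ (X * derivative ℂ G) = C t * G * E) :
    derivative ℂ (X * derivative ℂ (X * derivative ℂ (F * G))) =
      (2 * C t * (G * (X * derivative ℂ F) - F * (X * derivative ℂ G))) * E ∧
    derivative ℂ (2 * C t * (G * (X * derivative ℂ F) - F * (X * derivative ℂ G))) =
      C (-4 * t ^ 2) * (F * G) * E := by
  have dC : ∀ (c : ℂ) (f : ℂ⟦X⟧), derivative ℂ (C c * f) = C c * derivative ℂ f := by
    intro c f
    rw [Derivation.leibniz, derivative_C]; simp
  have h2 : (2 : ℂ⟦X⟧) = C 2 := (map_ofNat C 2).symm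
  have h4 : (C 4 : ℂ⟦X⟧) = 4 := map_ofNat C 4
  have h1 : X * derivative ℂ (X * derivative ℂ (F * G)) =
      C 2 * ((X * derivative ℂ F) * (X * derivative ℂ G)) := by
    have : X * derivative ℂ (F * G) = F * (X * derivative ℂ G) + G * (X * derivative ℂ F) := by
      rw [Derivation.leibniz, smul_eq_mul, smul_eq_mul]; ring
    rw [this, map_add, Derivation.leibniz _ F, Derivation.leibniz _ G, hF, hG, ← h2]
    simp only [smul_eq_mul]
    ring
  constructor
  · rw [h1, dC, Derivation.leibniz, hF, hG, ← h2]
    simp only [smul_eq_mul]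
    ring
  · rw [h2, mul_assoc, dC, dC, map_sub, Derivation.leibniz _ F, Derivation.leibniz _ G, hF, hG, ← h2]
    simp only [smul_eq_mul, map_mul, map_neg, map_pow, h4]
    ring

open PowerSeries in
theorem coeff_mul_E (F : ℂ⟦X⟧) (n : ℕ) :
    coeff n (F * mk 1) = ∑ k ∈ Finset.range (n + 1), coeff k F := by
  rw [coeff_mul, Finset.Nat.sum_antidiagonal_eq_sum_range_succ_mk]
  simp

noncomputable def QQ (t : ℂ) (n : ℕ) : ℂ := ∏ j ∈ Finset.range n, (1 - t / ((j : ℂ) + 1) ^ 2)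

noncomputable def AA (t : ℂ) : ℕ → ℂ
  | 0 => 1
  | k + 1 => -t / ((k : ℂ) + 1) ^ 2 * QQ t k

theorem sum_AA (t : ℂ) (n : ℕ) : ∑ k ∈ Finset.range (n + 1), AA t k = QQ t n := by
  induction n with
  | zero => simp [AA, QQ]
  | succ n ih =>
    rw [Finset.sum_range_succ, ih, AA]
    simp only [QQ]
    rw [Finset.prod_range_succ]
    ring

open PowerSeries in
theorem ode_AA (t : ℂ) :
    derivative ℂ (X * derivative ℂ (mk (AA t))) = - C t * mk (AA t) * mk 1 := by
  ext n
  rw [coeff_mul_E, coeff_derivative, coeff_succ_X_mul, coeff_derivative, coeff_mk]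
  have : ∀ k, coeff k (-C t * mk (AA t)) = -t * AA t k := by
    intro k
    rw [← map_neg, coeff_C_mul, coeff_mk]
  simp only [this]
  rw [← Finset.mul_sum, sum_AA, AA]
  have : (n : ℂ) + 1 ≠ 0 := by exact_mod_cast Nat.succ_ne_zero n
  field_simp

noncomputable def PP (t : ℂ) (n : ℕ) : ℂ :=
  ∑ kl ∈ Finset.HasAntidiagonal.antidiagonal n, AA t kl.1 * AA (-t) kl.2

open PowerSeries in
theorem PP_rec (t : ℂ) (n : ℕ) : ((n : ℂ) + 1) ^ 3 * PP t (n + 1) =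
    ∑ m ∈ Finset.range n, (-4 * t ^ 2) / ((m : ℂ) + 1) * ∑ l ∈ Finset.range (m + 1), PP t l := by
  have hP : ∀ k, coeff k (mk (AA t) * mk (AA (-t))) = PP t k := by
    intro k; rw [coeff_mul]; simp [PP]
  obtain ⟨h1, h2⟩ := alg_core (mk (AA t)) (mk (AA (-t))) (mk 1) t (ode_AA t)
    (by rw [ode_AA]; simp)
  set V := (2 * C t * (mk (AA (-t)) * (X * derivative ℂ (mk (AA t))) -
    mk (AA t) * (X * derivative ℂ (mk (AA (-t)))))) with hV
  have V0 : coeff 0 V = 0 := by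
    rw [hV]; simp
  have hn : (n : ℂ) + 1 ≠ 0 := by exact_mod_cast Nat.succ_ne_zero n
  have e1 := congrArg (coeff n) h1
  rw [coeff_mul_E, coeff_derivative, coeff_succ_X_mul, coeff_derivative, coeff_succ_X_mul,
    coeff_derivative, hP, Finset.sum_range_succ', V0, add_zero] at e1
  rw [show ((n : ℂ) + 1) ^ 3 * PP t (n + 1) = PP t (n + 1) * (n + 1) * (n + 1) * (n + 1) by ring, e1]
  refine Finset.sum_congr rfl fun m _ => ?_
  have hm : (m : ℂ) + 1 ≠ 0 := by exact_mod_cast Nat.succ_ne_zero m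
  have e2 := congrArg (coeff m) h2
  rw [coeff_mul_E, coeff_derivative] at e2
  simp only [coeff_C_mul, hP] at e2
  rw [← Finset.mul_sum] at e2
  field_simp
  linear_combination e2

open scoped NNReal ENNReal Classical in
noncomputable def ZZ (s : List ℕ) (N : ℕ∞) : ENNReal :=
  ∑' k : Fin s.length → ℕ, if StrictAnti k ∧ ∀ i, 0 < k i ∧ (k i : ℕ∞) < N then
    ∏ i, ((((k i : NNReal) ^ s.get i)⁻¹ : NNReal) : ENNReal) else 0

theorem mzv_eq (s : List ℕ) : mzv s = (ZZ s ⊤).toReal := by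
  classical
  unfold mzv ZZ
  rw [ENNReal.tsum_toReal_eq]
  · have := tsum_subtype {k : Fin s.length → ℕ | StrictAnti k ∧ ∀ i, 0 < k i}
      (fun k => ∏ i, 1 / ((k i : ℝ) ^ s.get i))
    refine this.trans ?_
    refine tsum_congr fun k => ?_
    by_cases h : StrictAnti k ∧ ∀ i, 0 < k i
    · rw [Set.indicator_of_mem (by exact h), if_pos ⟨h.1, fun i => ⟨h.2 i, by simp⟩⟩,
        ENNReal.toReal_prod]
      simp
    · rw [Set.indicator_of_notMem (by exact h), if_neg (fun h' => h ⟨h'.1, fun i => (h'.2 i).1⟩)]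
      simp
  · intro a
    split_ifs
    · exact ENNReal.prod_ne_top fun i _ => ENNReal.coe_ne_top
    · simp

theorem ZZ_nil (N : ℕ∞) : ZZ [] N = 1 := by
  unfold ZZ
  simp [StrictAnti]

open Classical in
theorem ZZ_cons (a : ℕ) (s : List ℕ) (N : ℕ∞) : ZZ (a :: s) N =
    ∑' k : ℕ, if 0 < k ∧ (k : ℕ∞) < N then ((((k : NNReal) ^ a)⁻¹ : NNReal) : ENNReal) * ZZ s k else 0 := by
  unfold ZZ
  have e := (Fin.consEquiv (n := s.length) (fun _ => ℕ)).tsum_eq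
    (fun k : Fin (a :: s).length → ℕ => if StrictAnti k ∧ ∀ i, 0 < k i ∧ (k i : ℕ∞) < N then
    ∏ i, ((((k i : NNReal) ^ (a :: s).get i)⁻¹ : NNReal) : ENNReal) else 0)
  refine e.symm.trans ?_
  rw [ENNReal.tsum_prod']
  refine tsum_congr fun k => ?_
  have key : ∀ x : Fin s.length → ℕ,
      (StrictAnti (Fin.cons k x : Fin (s.length + 1) → ℕ) ∧
        ∀ i, 0 < (Fin.cons k x : Fin (s.length + 1) → ℕ) i ∧
          ((Fin.cons k x : Fin (s.length + 1) → ℕ) i : ℕ∞) < N) ↔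
      (0 < k ∧ (k : ℕ∞) < N) ∧ (StrictAnti x ∧ ∀ i, 0 < x i ∧ (x i : ℕ∞) < (k : ℕ∞)) := by
    intro x
    simp only [Fin.forall_fin_succ, Fin.cons_zero, Fin.cons_succ]
    constructor
    · rintro ⟨h1, h2, h3⟩
      refine ⟨h2, fun i j hij => ?_, fun i => ⟨(h3 i).1, ?_⟩⟩
      · simpa using h1 (Fin.succ_lt_succ_iff.2 hij)
      · have := h1 (Fin.succ_pos i)
        simp only [Fin.cons_zero, Fin.cons_succ] at this
        exact_mod_cast this
    · rintro ⟨h1, h2, h3⟩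
      refine ⟨?_, h1, fun i => ⟨(h3 i).1, (h3 i).2.trans h1.2⟩⟩
      intro i j hij
      induction j using Fin.cases with
      | zero => simp at hij
      | succ j =>
        induction i using Fin.cases with
        | zero => simpa using (h3 j).2
        | succ i => simpa using h2 (Fin.succ_lt_succ_iff.1 hij)
  split_ifs with h
  · rw [← ENNReal.tsum_mul_left]
    refine tsum_congr fun x => ?_
    have := key x
    simp only [h, true_and, and_self] at this
    by_cases hx : StrictAnti x ∧ ∀ i, 0 < x i ∧ (x i : ℕ∞) < (k : ℕ∞)
    · rw [if_pos hx]
      exact (if_pos (this.2 hx)).trans (Fin.prod_univ_succ _)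
    · rw [if_neg hx, mul_zero]
      exact if_neg (fun h => hx (this.1 h))
  · rw [ENNReal.tsum_eq_zero]
    intro x
    exact if_neg (fun h' => h ((key x).1 h').1)

noncomputable def cc : ℕ → ℕ → NNReal
  | 0, k => if k = 0 then 1 else 0
  | _ + 1, 0 => 0
  | n + 1, k + 1 => (((k : NNReal) + 1) ^ 3)⁻¹ *
      ∑ m ∈ Finset.range k, ((m : NNReal) + 1)⁻¹ * ∑ l ∈ Finset.range (m + 1), cc n l

theorem tsum_lt (f : ℕ → ENNReal) (N : ℕ) :
    (∑' k : ℕ, if 0 < k ∧ (k : ℕ∞) < ((N + 1 : ℕ) : ℕ∞) then f k else 0)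
      = ∑ k ∈ Finset.range N, f (k + 1) := by
  rw [tsum_eq_sum (s := Finset.range (N + 1))]
  · rw [Finset.sum_range_succ']
    simp only [lt_self_iff_false, false_and, if_false, add_zero]
    refine Finset.sum_congr rfl fun k hk => ?_
    rw [if_pos]
    refine ⟨by omega, ?_⟩
    have := Finset.mem_range.1 hk
    exact_mod_cast (by omega : k + 1 < N + 1)
  · intro k hk
    rw [if_neg]
    rintro ⟨_, h⟩
    exact hk (Finset.mem_range.2 (by exact_mod_cast h))

theorem ZZ_step (n : ℕ) (k : ℕ)
    (ih : ∀ N : ℕ, ZZ (List.flatten (List.replicate n [3, 1])) ((N + 1 : ℕ) : ℕ∞) =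
      ((∑ l ∈ Finset.range (N + 1), cc n l : NNReal) : ENNReal)) :
    (((((k + 1 : ℕ) : NNReal) ^ 3)⁻¹ : NNReal) : ENNReal) *
      ZZ (1 :: List.flatten (List.replicate n [3, 1])) ((k + 1 : ℕ) : ℕ∞) = (cc (n + 1) (k + 1) : ENNReal) := by
  rw [ZZ_cons, tsum_lt, cc]
  simp only [ih]
  push_cast
  simp

theorem ZZ_fin (n : ℕ) : ∀ N : ℕ, ZZ (List.flatten (List.replicate n [3, 1])) ((N + 1 : ℕ) : ℕ∞) =
      ((∑ l ∈ Finset.range (N + 1), cc n l : NNReal) : ENNReal) := by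
  induction n with
  | zero => intro N; simp [ZZ_nil, cc]
  | succ n ih =>
    intro N
    have : List.flatten (List.replicate (n + 1) [3, 1]) =
      3 :: 1 :: List.flatten (List.replicate n [3, 1]) := by
      simp [List.replicate_succ]
    rw [this, ZZ_cons, tsum_lt, Finset.sum_range_succ']
    simp only [ZZ_step n _ ih, cc, add_zero]
    push_cast
    rfl

theorem ZZ_top (n : ℕ) : ZZ (List.flatten (List.replicate (n + 1) [3, 1])) ⊤ =
      ∑' k, (cc (n + 1) k : ENNReal) := by
  have : List.flatten (List.replicate (n + 1) [3, 1]) =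
      3 :: 1 :: List.flatten (List.replicate n [3, 1]) := by
      simp [List.replicate_succ]
  rw [this, ZZ_cons]
  refine tsum_congr fun k => ?_
  cases k with
  | zero => simp [cc]
  | succ k =>
    rw [if_pos ⟨by omega, by exact WithTop.coe_lt_top _⟩]
    exact ZZ_step n k (ZZ_fin n)

theorem mzv_cc (n : ℕ) (hn : 0 < n) : mzv (List.flatten (List.replicate n [3, 1])) =
    ∑' k, (cc n k : ℝ) := by
  obtain ⟨n, rfl⟩ : ∃ m, n = m + 1 := ⟨n - 1, by omega⟩
  rw [mzv_eq, ZZ_top, ENNReal.tsum_toReal_eq (fun _ => ENNReal.coe_ne_top)]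
  rfl

theorem cc_zero : ∀ n k : ℕ, k < n → cc n k = 0 := by
  intro n
  induction n with
  | zero => intro k hk; omega
  | succ n ih =>
    intro k hk
    cases k with
    | zero => rfl
    | succ k =>
      rw [cc, Finset.sum_eq_zero, mul_zero]
      intro m hm
      rw [Finset.sum_eq_zero, mul_zero]
      intro l hl
      rw [Finset.mem_range] at hm hl
      exact ih l (by omega)

theorem PP_eq (t : ℂ) : ∀ k M : ℕ, k < M →
    PP t k = ∑ n ∈ Finset.range M, (-4 * t ^ 2) ^ n * ((cc n k : ℝ) : ℂ) := by
  intro k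
  induction k using Nat.strong_induction_on with
  | _ k ih =>
    intro M hM
    obtain ⟨M, rfl⟩ : ∃ m, M = m + 1 := ⟨M - 1, by omega⟩
    rw [Finset.sum_range_succ']
    cases k with
    | zero => simp [PP, AA, cc]
    | succ k =>
      have hk : (k : ℂ) + 1 ≠ 0 := by exact_mod_cast Nat.succ_ne_zero k
      apply mul_left_cancel₀ (pow_ne_zero 3 hk)
      rw [PP_rec]
      have : ∀ m ∈ Finset.range k, (-4 * t ^ 2) / ((m : ℂ) + 1) * ∑ l ∈ Finset.range (m + 1), PP t l
          = ∑ n ∈ Finset.range M, (-4 * t ^ 2) ^ (n + 1) *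
            (((m : ℂ) + 1)⁻¹ * ∑ l ∈ Finset.range (m + 1), ((cc n l : ℝ) : ℂ)) := by
        intro m hm
        rw [Finset.mem_range] at hm
        rw [Finset.sum_congr rfl (fun l hl => ih l (by rw [Finset.mem_range] at hl; omega) M
          (by rw [Finset.mem_range] at hl; omega)), Finset.sum_comm, Finset.mul_sum]
        refine Finset.sum_congr rfl fun n _ => ?_
        rw [← Finset.mul_sum, pow_succ]
        ring
      rw [Finset.sum_congr rfl this, Finset.sum_comm]
      simp only [cc]
      rw [if_neg (by omega)]
      simp only [NNReal.coe_zero, Complex.ofReal_zero, mul_zero, add_zero]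
      rw [Finset.mul_sum]
      refine Finset.sum_congr rfl fun n _ => ?_
      rw [← Finset.mul_sum]
      push_cast
      field_simp

theorem PP_hasSum (t : ℂ) (k : ℕ) :
    HasSum (fun n => (-4 * t ^ 2) ^ n * ((cc n k : ℝ) : ℂ)) (PP t k) := by
  rw [PP_eq t k (k + 1) (by omega)]
  apply hasSum_sum_of_ne_finset_zero
  intro n hn
  rw [Finset.mem_range] at hn
  rw [cc_zero n k (by omega)]
  simp

open Filter Topology

theorem QQ_tendsto (t : ℂ) : ∃ L, Tendsto (QQ t) atTop (𝓝 L) ∧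
    ∀ a : ℂ, a ^ 2 = t → (Real.pi : ℂ) * a * L = Complex.sin (Real.pi * a) := by
  have hpi : (Real.pi : ℂ) ≠ 0 := by exact_mod_cast Real.pi_ne_zero
  by_cases ht : t = 0
  · refine ⟨1, ?_, ?_⟩
    · have : QQ t = fun _ => 1 := by funext n; simp [QQ, ht]
      rw [this]; exact tendsto_const_nhds
    · intro a ha
      have : a = 0 := by rw [ht] at ha; exact pow_eq_zero_iff (two_ne_zero) |>.1 ha
      simp [this]
  · obtain ⟨a, ha⟩ := IsAlgClosed.exists_pow_nat_eq t (n := 2) (by norm_num)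
    have ha0 : ∀ b : ℂ, b ^ 2 = t → b ≠ 0 := by rintro b hb rfl; apply ht; rw [← hb]; simp
    have key : ∀ b : ℂ, b ^ 2 = t →
        Tendsto (QQ t) atTop (𝓝 (Complex.sin (Real.pi * b) / (Real.pi * b))) := by
      intro b hb
      have h0 := mul_ne_zero hpi (ha0 b hb)
      have := (Complex.tendsto_euler_sin_prod b).div_const (Real.pi * b)
      refine this.congr fun n => ?_
      rw [mul_div_cancel_left₀ _ h0, hb]; rfl
    refine ⟨_, key a ha, fun b hb => ?_⟩
    rw [tendsto_nhds_unique (key a ha) (key b hb), mul_div_cancel₀]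
    exact mul_ne_zero hpi (ha0 b hb)

theorem AA_summable (t : ℂ) : Summable (fun k => ‖AA t k‖) := by
  obtain ⟨L, hL, -⟩ := QQ_tendsto t
  obtain ⟨B, hB⟩ := hL.norm.bddAbove_range
  rw [← summable_nat_add_iff 1]
  have h2 : Summable (fun k : ℕ => (‖t‖ * B) * (1 / ((k + 1 : ℕ) : ℝ) ^ 2)) :=
    ((summable_nat_add_iff 1).2 (Real.summable_one_div_nat_pow.2 (by norm_num : 1 < 2))).mul_left _
  refine Summable.of_nonneg_of_le (fun _ => norm_nonneg _) (fun k => ?_) h2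
  have : ‖QQ t k‖ ≤ B := hB ⟨k, rfl⟩
  have e : ‖(k : ℂ) + 1‖ = (k : ℝ) + 1 := by
    rw [← Nat.cast_succ, Complex.norm_natCast, Nat.cast_succ]
  rw [AA, norm_mul, norm_div, norm_neg, norm_pow, e]
  push_cast
  calc ‖t‖ / ((k : ℝ) + 1) ^ 2 * ‖QQ t k‖ ≤ ‖t‖ / ((k : ℝ) + 1) ^ 2 * B := by gcongr
    _ = _ := by ring

theorem AA_hasSum (t L : ℂ) (hL : Tendsto (QQ t) atTop (𝓝 L)) : HasSum (AA t) L := by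
  rw [(AA_summable t).of_norm.hasSum_iff_tendsto_nat, ← tendsto_add_atTop_iff_nat 1]
  simpa only [sum_AA] using hL

theorem PP_summable (t : ℂ) : Summable (fun k => ‖PP t k‖) :=
  summable_norm_sum_mul_antidiagonal_of_summable_norm (AA_summable t) (AA_summable (-t))

theorem PP_tsum (t L L' : ℂ) (hL : Tendsto (QQ t) atTop (𝓝 L))
    (hL' : Tendsto (QQ (-t)) atTop (𝓝 L')) : ∑' k, PP t k = L * L' := by
  rw [← (AA_hasSum t L hL).tsum_eq, ← (AA_hasSum (-t) L' hL').tsum_eq,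
    tsum_mul_tsum_eq_tsum_sum_antidiagonal_of_summable_norm (AA_summable t) (AA_summable (-t))]
  rfl

theorem exists_t (y : ℂ) : ∃ t : ℂ, -4 * t ^ 2 = y := by
  obtain ⟨t, ht⟩ := IsAlgClosed.exists_pow_nat_eq (-y / 4) (n := 2) (by norm_num)
  exact ⟨t, by rw [ht]; ring⟩

theorem double_summable (y : ℂ) :
    Summable (fun p : ℕ × ℕ => y ^ p.2 * ((cc p.2 p.1 : ℝ) : ℂ)) := by
  apply Summable.of_norm
  obtain ⟨t, ht⟩ := exists_t ((‖y‖ : ℝ) : ℂ)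
  have hs : ∀ k, HasSum (fun n => ‖y ^ n * ((cc n k : ℝ) : ℂ)‖) ‖PP t k‖ := by
    intro k
    have h := PP_hasSum t k
    rw [ht] at h
    have h' : (fun n => ((‖y‖ : ℝ) : ℂ) ^ n * ((cc n k : ℝ) : ℂ)) =
        fun n => ((‖y ^ n * ((cc n k : ℝ) : ℂ)‖ : ℝ) : ℂ) := by
      funext n
      simp
    rw [h'] at h
    have hsum : Summable (fun n => ‖y ^ n * ((cc n k : ℝ) : ℂ)‖) := by
      exact_mod_cast h.summable
    have h2 := hsum.hasSum
    have : PP t k = ((∑' n, ‖y ^ n * ((cc n k : ℝ) : ℂ)‖ : ℝ) : ℂ) :=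
      h.unique (Complex.hasSum_ofReal.2 h2)
    rw [this, Complex.norm_real, Real.norm_of_nonneg (tsum_nonneg fun _ => norm_nonneg _)]
    exact h2
  rw [summable_prod_of_nonneg (fun _ => norm_nonneg _)]
  refine ⟨fun k => (hs k).summable, ?_⟩
  have : (fun k => ∑' n, ‖y ^ n * ((cc n k : ℝ) : ℂ)‖) = fun k => ‖PP t k‖ := by
    funext k; exact (hs k).tsum_eq
  show Summable (fun k => ∑' n, ‖y ^ n * ((cc n k : ℝ) : ℂ)‖)
  rw [this]
  exact PP_summable t

theorem cc_summable (n : ℕ) : Summable (fun k => ((cc n k : ℝ) : ℂ)) := by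
  have := (double_summable 1).prod_symm.prod_factor n
  simpa using this

theorem main_hasSum (t : ℂ) :
    HasSum (fun n => (-4 * t ^ 2) ^ n * ((∑' k, (cc n k : ℝ) : ℝ) : ℂ)) (∑' k, PP t k) := by
  have hd := double_summable (-4 * t ^ 2)
  have h1 : HasSum (PP t) (∑' p : ℕ × ℕ, (-4 * t ^ 2) ^ p.2 * ((cc p.2 p.1 : ℝ) : ℂ)) :=
    hd.hasSum.prod_fiberwise (fun k => PP_hasSum t k)
  rw [h1.tsum_eq]
  have h2 := hd.hasSum
  rw [← (Equiv.prodComm ℕ ℕ).hasSum_iff] at h2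
  refine h2.prod_fiberwise (fun n => ?_)
  simp only [Function.comp, Equiv.prodComm_apply, Prod.swap]
  rw [Complex.ofReal_tsum]
  exact (cc_summable n).hasSum.mul_left _

theorem trig_series (w : ℂ) : HasSum
    (fun n : ℕ => Complex.I * w ^ 2 * (2 * ((-4) ^ n * w ^ (4 * n)) / (Nat.factorial (4 * n + 2) : ℂ)))
    (Complex.sin w * Complex.sin (Complex.I * w)) := by
  have h := ((Complex.hasSum_cos (w - Complex.I * w)).sub
    (Complex.hasSum_cos (w + Complex.I * w))).div_const 2
  have e : (Complex.cos (w - Complex.I * w) - Complex.cos (w + Complex.I * w)) / 2 =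
      Complex.sin w * Complex.sin (Complex.I * w) := by
    rw [Complex.cos_sub, Complex.cos_add]; ring
  rw [e] at h
  have e1 : (w - Complex.I * w) ^ 2 = -(2 * Complex.I * w ^ 2) := by
    linear_combination w ^ 2 * Complex.I_sq
  have e2 : (w + Complex.I * w) ^ 2 = 2 * Complex.I * w ^ 2 := by
    linear_combination w ^ 2 * Complex.I_sq
  simp only [pow_mul, e1, e2] at h
  have inj : Function.Injective (fun n : ℕ => 2 * n + 1) := by
    intro a b hab; simpa using hab
  rw [← inj.hasSum_iff] at h
  · refine Eq.mp (congrArg (fun f : ℕ → ℂ => HasSum f _) (funext fun n => ?_)) h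
    symm
    simp only [Function.comp]
    rw [show 2 * (2 * n + 1) = 4 * n + 2 by ring, Odd.neg_pow (n := 2 * n + 1) ⟨n, rfl⟩,
      Odd.neg_pow (n := 2 * n + 1) ⟨n, rfl⟩]
    have hp : (2 * Complex.I * w ^ 2) ^ (2 * n + 1) =
        (-4) ^ n * w ^ (4 * n) * (2 * Complex.I * w ^ 2) := by
      rw [pow_succ, pow_mul, pow_mul w, ← mul_pow]
      congr 2
      linear_combination 4 * w ^ 4 * Complex.I_sq
    rw [hp, one_pow]
    ring
  · intro m hm
    have : Even m := by
      by_contra hodd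
      rw [Nat.not_even_iff_odd] at hodd
      obtain ⟨r, hr⟩ := hodd
      exact hm ⟨r, hr.symm⟩
    rw [this.neg_pow, this.neg_pow]
    simp

theorem rhs_hasSum (t : ℂ) : HasSum (fun n : ℕ => (-4 * t ^ 2) ^ n *
    ((2 * Real.pi ^ (4 * n) / Nat.factorial (4 * n + 2) : ℝ) : ℂ)) (∑' k, PP t k) := by
  obtain ⟨L, hL, hL2⟩ := QQ_tendsto t
  obtain ⟨L', hL', hL2'⟩ := QQ_tendsto (-t)
  rw [PP_tsum t L L' hL hL']
  obtain ⟨a, ha⟩ := IsAlgClosed.exists_pow_nat_eq t (n := 2) (by norm_num)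
  have hpi : (Real.pi : ℂ) ≠ 0 := by exact_mod_cast Real.pi_ne_zero
  by_cases ht : t = 0
  · have q0 : ∀ n, QQ 0 n = 1 := fun n => by simp [QQ]
    rw [ht] at hL hL'
    rw [neg_zero] at hL'
    have l1 : L = 1 := tendsto_nhds_unique hL (by simp only [funext q0]; exact tendsto_const_nhds)
    have l2 : L' = 1 := tendsto_nhds_unique hL' (by simp only [funext q0]; exact tendsto_const_nhds)
    rw [l1, l2]
    convert hasSum_single (α := ℂ) (f := fun n : ℕ => (-4 * t ^ 2) ^ n *
      ((2 * Real.pi ^ (4 * n) / Nat.factorial (4 * n + 2) : ℝ) : ℂ)) 0 ?_ using 1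
    · simp
    · intro n hn
      simp [ht, hn]
  · have ha0 : a ≠ 0 := by rintro rfl; apply ht; rw [← ha]; simp
    have h := trig_series (Real.pi * a)
    have h1 := hL2 a ha
    have h2 := hL2' (Complex.I * a) (by rw [mul_pow, Complex.I_sq, ha]; ring)
    rw [show (Complex.I * (Real.pi * a) : ℂ) = Real.pi * (Complex.I * a) by ring, ← h1, ← h2] at h
    have hne : Complex.I * (Real.pi * a) ^ 2 ≠ 0 :=
      mul_ne_zero Complex.I_ne_zero (pow_ne_zero 2 (mul_ne_zero hpi ha0))
    rw [← hasSum_mul_left_iff hne]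
    convert h using 1
    · rfl
    · funext n
      rw [← ha]
      push_cast
      rw [mul_pow (-4 : ℂ), mul_pow (Real.pi : ℂ) a (4 * n), ← pow_mul, ← pow_mul,
        show 2 * (2 * n) = 4 * n by ring]
      ring
    · ring

theorem zeta_all (n : ℕ) : ∑' k, (cc n k : ℝ) =
    2 * Real.pi ^ (4 * n) / Nat.factorial (4 * n + 2) := by
  choose T hT using exists_t
  have key : ∀ p : ℕ → ℂ, (∀ t : ℂ, HasSum (fun n : ℕ => (-4 * t ^ 2) ^ n * p n) (∑' k, PP t k)) →
      HasFPowerSeriesAt (fun y => ∑' k, PP (T y) k) (FormalMultilinearSeries.ofScalars ℂ p) 0 := by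
    intro p hp
    rw [hasFPowerSeriesAt_iff]
    refine Eventually.of_forall fun y => ?_
    simp only [FormalMultilinearSeries.coeff_ofScalars, smul_eq_mul, zero_add]
    have := hp (T y)
    rwa [hT] at this
  have := (key _ main_hasSum).eq_formalMultilinearSeries (key _ rhs_hasSum)
  have h2 := congrArg (fun q => FormalMultilinearSeries.coeff q n) this
  simp only [FormalMultilinearSeries.coeff_ofScalars] at h2
  exact_mod_cast h2

/-- For every positive integer `n`, `ζ({3,1}^n) = 2·π^(4n) / (4n+2)!`. -/
theorem zeta_threeone_pow (n : ℕ) (hn : 0 < n) :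
    mzv (List.flatten (List.replicate n [3, 1]))
      = 2 * Real.pi ^ (4 * n) / Nat.factorial (4 * n + 2) := by
  rw [mzv_cc n hn, zeta_all]
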